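/- Let A be a C*-algebra. Then ker T_A (the intersection of all members of T_A) is a weakly central ideal of A, and it contains every weakly central ideal of A; that is, ker T_A is the largest weakly central ideal of A. -/

import Mathlib

open Filter Topology Pointwise

namespace CQP

variable {R : Type*} [NonUnitalRing R] [TopologicalSpace R]

/-- `I` is a closed two-sided ideal of the (C*-)algebra `S` (a subset of the ambient algebra). -/
def IsIdealOf (I S : Set R) : Prop :=
  I ⊆ S ∧ IsClosed I ∧ (0 : R) ∈ I ∧
  (∀ x ∈ I, ∀ y ∈ I, x + y ∈ I) ∧ (∀ x ∈ I, -x ∈ I) ∧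
  (∀ x ∈ I, ∀ a ∈ S, a * x ∈ I ∧ x * a ∈ I)

/-- The centre of the algebra `S`. -/
def centerOf (S : Set R) : Set R := {z ∈ S | ∀ x ∈ S, z * x = x * z}

/-- `e` is a unit for `S` relative to (modulo) the ideal `M`. -/
def IsRelUnitMod (S M : Set R) (e : R) : Prop :=
  e ∈ S ∧ ∀ x ∈ S, x - x * e ∈ M ∧ x - e * x ∈ M

/-- `M` is a modular maximal ideal of the algebra `S`. -/
def IsModMaxIdealOf (M S : Set R) : Prop :=
  IsIdealOf M S ∧ M ≠ S ∧
  (∀ I, IsIdealOf I S → M ⊆ I → I = M ∨ I = S) ∧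
  ∃ e, IsRelUnitMod S M e

/-- The algebra `S` is weakly central. -/
def WeaklyCentral (S : Set R) : Prop :=
  (∀ M, IsModMaxIdealOf M S → ¬ centerOf S ⊆ M) ∧
  (∀ M N, IsModMaxIdealOf M S → IsModMaxIdealOf N S →
    M ∩ centerOf S = N ∩ centerOf S → M = N)

/-- The algebra `S` has the centre-quotient property: every central element of a quotient
of `S` lifts to a central element of `S` modulo the ideal. -/
def HasCQ (S : Set R) : Prop :=
  ∀ I, IsIdealOf I S → ∀ a ∈ S, (∀ x ∈ S, a * x - x * a ∈ I) →
    ∃ z ∈ centerOf S, a - z ∈ I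

/-- `a` is a CQ-element of the algebra `S`. -/
def IsCQElem (S : Set R) (a : R) : Prop :=
  a ∈ S ∧ ∀ I, IsIdealOf I S → (∀ x ∈ S, a * x - x * a ∈ I) →
    ∃ z ∈ centerOf S, a - z ∈ I

/-- The set of CQ-elements of `S`. -/
def CQset (S : Set R) : Set R := {a | IsCQElem S a}

/-- The set `T_A` of modular maximal ideals witnessing the failure of weak centrality. -/
def Tset (S : Set R) : Set (Set R) :=
  {M | IsModMaxIdealOf M S ∧
    (centerOf S ⊆ M ∨ ∃ N, IsModMaxIdealOf N S ∧ N ≠ M ∧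
      ¬ centerOf S ⊆ M ∧ ¬ centerOf S ⊆ N ∧ M ∩ centerOf S = N ∩ centerOf S)}

/-- The closed two-sided ideal of `S` generated by the set `X`. -/
def genIdealOf (S X : Set R) : Set R := ⋂₀ {I | IsIdealOf I S ∧ X ⊆ I}

/-- The quotient `A/J` (of the full algebra by the ideal `J`) has the centre-quotient
property, expressed via the correspondence between ideals of `A/J` and ideals of `A`
containing `J`. -/
def HasCQmod (J : Set R) : Prop :=
  ∀ I : Set R, IsIdealOf I (Set.univ : Set R) → J ⊆ I → ∀ a : R,
    (∀ x : R, a * x - x * a ∈ I) →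
      ∃ z : R, (∀ x : R, z * x - x * z ∈ J) ∧ a - z ∈ I


end CQP

namespace CQP

/-- A (not necessarily closed) two-sided ideal, as a set. -/
structure IsAlgIdeal {R : Type*} [NonUnitalRing R] (L : Set R) : Prop where
  zero : (0 : R) ∈ L
  add : ∀ {x y}, x ∈ L → y ∈ L → x + y ∈ L
  neg : ∀ {x}, x ∈ L → -x ∈ L
  left : ∀ {x} (a), x ∈ L → a * x ∈ L
  right : ∀ {x} (a), x ∈ L → x * a ∈ L

section Ring

variable {R : Type*} [NonUnitalRing R]

lemma IsAlgIdeal.sub {L : Set R} (hL : IsAlgIdeal L) {x y : R} (hx : x ∈ L) (hy : y ∈ L) :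
    x - y ∈ L := sub_eq_add_neg x y ▸ hL.add hx (hL.neg hy)

lemma IsAlgIdeal.mem_of_sub_mem {L : Set R} (hL : IsAlgIdeal L) {x y : R} (h : x - y ∈ L)
    (hy : y ∈ L) : x ∈ L := by
  simpa using hL.add h hy

lemma IsAlgIdeal.setAdd {L M : Set R} (hL : IsAlgIdeal L) (hM : IsAlgIdeal M) :
    IsAlgIdeal (L + M) where
  zero := ⟨0, hL.zero, 0, hM.zero, add_zero 0⟩
  add := by
    rintro _ _ ⟨a, ha, b, hb, rfl⟩ ⟨c, hc, d, hd, rfl⟩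
    exact ⟨a + c, hL.add ha hc, b + d, hM.add hb hd, add_add_add_comm ..⟩
  neg := by
    rintro _ ⟨a, ha, b, hb, rfl⟩
    exact ⟨-a, hL.neg ha, -b, hM.neg hb, (neg_add a b).symm⟩
  left := by
    rintro _ x ⟨a, ha, b, hb, rfl⟩
    exact ⟨x * a, hL.left x ha, x * b, hM.left x hb, (mul_add x a b).symm⟩
  right := by
    rintro _ x ⟨a, ha, b, hb, rfl⟩
    exact ⟨a * x, hL.right x ha, b * x, hM.right x hb, (add_mul a b x).symm⟩

lemma mem_centerOf_univ {z : R} : z ∈ centerOf Set.univ ↔ ∀ x, z * x = x * z := by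
  simp [centerOf]

lemma mul_mem_centerOf_univ {y z : R} (hy : y ∈ centerOf Set.univ) (hz : z ∈ centerOf Set.univ) :
    y * z ∈ centerOf Set.univ := by
  rw [mem_centerOf_univ] at *
  intro x
  rw [mul_assoc, hz, ← mul_assoc, hy, mul_assoc]

lemma IsRelUnitMod.eq_univ {I : Set R} {e : R} (hI : IsAlgIdeal I)
    (h : IsRelUnitMod Set.univ I e) (he : e ∈ I) : I = Set.univ :=
  Set.eq_univ_of_forall fun x ↦ hI.mem_of_sub_mem (h.2 x trivial).1 (hI.left x he)

lemma IsRelUnitMod.mono {S I J : Set R} {e : R} (h : IsRelUnitMod S I e) (hIJ : I ⊆ J) :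
    IsRelUnitMod S J e :=
  ⟨h.1, fun x hx ↦ ⟨hIJ (h.2 x hx).1, hIJ (h.2 x hx).2⟩⟩

variable [TopologicalSpace R]

lemma isIdealOf_univ_iff {I : Set R} :
    IsIdealOf I Set.univ ↔ IsClosed I ∧ IsAlgIdeal I :=
  ⟨fun ⟨_, hc, h0, ha, hn, hm⟩ ↦ ⟨hc, h0, fun hx hy ↦ ha _ hx _ hy, fun hx ↦ hn _ hx,
      fun a hx ↦ (hm _ hx a trivial).1, fun a hx ↦ (hm _ hx a trivial).2⟩,
    fun ⟨hc, h⟩ ↦ ⟨Set.subset_univ _, hc, h.zero, fun _ hx _ hy ↦ h.add hx hy,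
      fun _ hx ↦ h.neg hx, fun _ hx a _ ↦ ⟨h.left a hx, h.right a hx⟩⟩⟩

lemma IsIdealOf.isClosed {I S : Set R} (h : IsIdealOf I S) : IsClosed I := h.2.1

lemma IsIdealOf.isAlgIdeal {I : Set R} (h : IsIdealOf I Set.univ) : IsAlgIdeal I :=
  (isIdealOf_univ_iff.1 h).2

lemma IsIdealOf.inter {I J : Set R} (hI : IsIdealOf I Set.univ) (hJ : IsIdealOf J Set.univ) :
    IsIdealOf (I ∩ J) J :=
  ⟨Set.inter_subset_right, hI.isClosed.inter hJ.isClosed,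
    ⟨hI.isAlgIdeal.zero, hJ.isAlgIdeal.zero⟩,
    fun _ hx _ hy ↦ ⟨hI.isAlgIdeal.add hx.1 hy.1, hJ.isAlgIdeal.add hx.2 hy.2⟩,
    fun _ hx ↦ ⟨hI.isAlgIdeal.neg hx.1, hJ.isAlgIdeal.neg hx.2⟩,
    fun _ hx a _ ↦ ⟨⟨hI.isAlgIdeal.left a hx.1, hJ.isAlgIdeal.left a hx.2⟩,
      ⟨hI.isAlgIdeal.right a hx.1, hJ.isAlgIdeal.right a hx.2⟩⟩⟩

lemma isIdealOf_univ_sInter {T : Set (Set R)} (hT : ∀ M ∈ T, IsIdealOf M Set.univ) :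
    IsIdealOf (⋂₀ T) Set.univ :=
  isIdealOf_univ_iff.2 ⟨isClosed_sInter fun M hM ↦ (hT M hM).isClosed,
    { zero := fun M hM ↦ (hT M hM).isAlgIdeal.zero
      add := fun hx hy M hM ↦ (hT M hM).isAlgIdeal.add (hx M hM) (hy M hM)
      neg := fun hx M hM ↦ (hT M hM).isAlgIdeal.neg (hx M hM)
      left := fun a hx M hM ↦ (hT M hM).isAlgIdeal.left a (hx M hM)
      right := fun a hx M hM ↦ (hT M hM).isAlgIdeal.right a (hx M hM) }⟩

variable [IsTopologicalRing R]

lemma IsAlgIdeal.closure {L : Set R} (hL : IsAlgIdeal L) : IsIdealOf (closure L) Set.univ :=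
  isIdealOf_univ_iff.2 ⟨isClosed_closure,
    { zero := subset_closure hL.zero
      add := fun hx hy ↦ map_mem_closure₂ continuous_add hx hy fun _ ha _ hb ↦ hL.add ha hb
      neg := fun hx ↦ map_mem_closure continuous_neg hx fun _ ha ↦ hL.neg ha
      left := fun a hx ↦ map_mem_closure (continuous_const_mul a) hx fun _ hb ↦ hL.left a hb
      right := fun a hx ↦ map_mem_closure (f := (· * a)) (continuous_mul_const a) hx
        fun _ hb ↦ hL.right a hb }⟩

end Ring

section CStar

variable {A : Type*} [NonUnitalCStarAlgebra A]

/-- A Neumann series argument. -/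
lemma exists_sub_mul_eq {d : A} (hd : ‖d‖ < 1) : ∃ y, y - d * y = d := by
  have hc : ContractingWith ‖d‖₊ (fun y ↦ d + d * y) := by
    refine ⟨by exact_mod_cast hd, LipschitzWith.of_dist_le_mul fun x y ↦ ?_⟩
    simpa [dist_eq_norm, ← mul_sub] using norm_mul_le d (x - y)
  refine ⟨hc.fixedPoint, ?_⟩
  have := hc.fixedPoint_isFixedPt
  rw [Function.IsFixedPt] at this
  exact sub_eq_iff_eq_add.2 this.symm

lemma IsRelUnitMod.mem_of_mem_closure {L : Set A} {g : A} (hL : IsAlgIdeal L)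
    (hg : IsRelUnitMod Set.univ L g) (h : g ∈ closure L) : g ∈ L := by
  obtain ⟨l, hl, hgl⟩ := Metric.mem_closure_iff.1 h 1 one_pos
  obtain ⟨y, hy⟩ := exists_sub_mul_eq (d := g - l) (by rwa [← dist_eq_norm])
  have key : g = l * (g + y) + (g - g * g) + (y - g * y) - ((g - l) - (g - l) * g) := by
    have : l * y = g * y - y + (g - l) := by
      rw [← hy, sub_mul]
      abel
    rw [mul_add, this, sub_mul]
    abel
  rw [key]
  exact hL.sub (hL.add (hL.add (hL.right _ hl) (hg.2 g trivial).1) (hg.2 y trivial).2)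
    (hg.2 _ trivial).1

lemma IsIdealOf.smul_mem {I : Set A} (hI : IsIdealOf I Set.univ) {𝕜 : Type*} [SMul 𝕜 A]
    [IsScalarTower 𝕜 A A] [SMulCommClass 𝕜 A A] (r : 𝕜) {x : A} (hx : x ∈ I) : r • x ∈ I := by
  let _ := CStarAlgebra.spectralOrder A
  let _ := CStarAlgebra.spectralOrderedRing A
  have h := (CStarAlgebra.increasingApproximateUnit A).tendsto_mul_right (r • x)
  refine hI.isClosed.mem_of_tendsto h (.of_forall fun e ↦ ?_)
  rw [mul_smul_comm, ← smul_mul_assoc]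
  exact hI.isAlgIdeal.left _ hx

lemma IsIdealOf.cfcₙ_mem {I : Set A} (hI : IsIdealOf I Set.univ) {c : A} (hc : c ∈ I)
    (hsa : IsSelfAdjoint c) (f : ℝ → ℝ) : cfcₙ f c ∈ I := by
  let S : NonUnitalStarSubalgebra ℝ A :=
    { carrier := I ∩ star ⁻¹' I
      zero_mem' := ⟨hI.isAlgIdeal.zero, by simpa using hI.isAlgIdeal.zero⟩
      add_mem' := fun hx hy ↦ ⟨hI.isAlgIdeal.add hx.1 hy.1, by
        simpa using hI.isAlgIdeal.add hx.2 hy.2⟩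
      mul_mem' := fun hx hy ↦ ⟨hI.isAlgIdeal.left _ hy.1, by
        simpa using hI.isAlgIdeal.right _ hy.2⟩
      smul_mem' := fun r x hx ↦ ⟨hI.smul_mem r hx.1, by simpa using hI.smul_mem r hx.2⟩
      star_mem' := fun hx ↦ ⟨hx.2, by simpa using hx.1⟩ }
  have hS : IsClosed (S : Set A) := hI.isClosed.inter (hI.isClosed.preimage continuous_star)
  have hcS : c ∈ S := ⟨hc, by simpa [hsa.star_eq] using hc⟩
  exact (_root_.cfcₙ_mem (hs := hS) f hcS).1

lemma cfcₙ_mem_centerOf {c : A} (hc : c ∈ centerOf Set.univ) (f : ℝ → ℝ) :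
    cfcₙ f c ∈ centerOf Set.univ := by
  rw [mem_centerOf_univ] at *
  exact fun x ↦ (Commute.cfcₙ_real (hc x) f)

/-- The piecewise linear function equal to `1` outside `(-t, t)` and to `0` at `0`. -/
noncomputable def plateau (t x : ℝ) : ℝ := min (|x| / t) 1

/-- Soft thresholding at level `t`. -/
noncomputable def threshold (t x : ℝ) : ℝ := x - max (-t) (min x t)

@[fun_prop]
lemma continuous_plateau (t : ℝ) : Continuous (plateau t) := by
  unfold plateau
  fun_prop

@[fun_prop]
lemma continuous_threshold (t : ℝ) : Continuous (threshold t) := by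
  unfold threshold
  fun_prop

@[simp] lemma plateau_zero (t : ℝ) : plateau t 0 = 0 := by simp [plateau]

lemma threshold_zero {t : ℝ} (ht : 0 < t) : threshold t 0 = 0 := by
  simp [threshold, ht.le]

lemma plateau_mul_threshold {t : ℝ} (ht : 0 < t) (x : ℝ) :
    plateau t x * threshold t x = threshold t x := by
  rcases le_total |x| t with h | h
  · have := abs_le.1 h
    simp [threshold, this.1, this.2]
  · rw [plateau, min_eq_right ((one_le_div ht).2 h), one_mul]

lemma abs_self_sub_threshold_le {t : ℝ} (ht : 0 < t) (x : ℝ) : |x - threshold t x| ≤ t := by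
  rw [threshold, sub_sub_cancel, abs_le]
  exact ⟨le_max_left _ _, max_le (by linarith) (min_le_right _ _)⟩

lemma abs_mul_one_sub_plateau_sq_le {t : ℝ} (ht : 0 < t) (x : ℝ) :
    |x - plateau t x * x - x * plateau t x + plateau t x * x * plateau t x| ≤ t := by
  have h : x - plateau t x * x - x * plateau t x + plateau t x * x * plateau t x
      = x * (1 - plateau t x) ^ 2 := by ring
  rw [h, abs_mul, abs_of_nonneg (sq_nonneg (1 - plateau t x))]
  rcases le_total |x| t with h | h
  · have h0 : 0 ≤ plateau t x := le_min (by positivity) zero_le_one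
    have h1 : plateau t x ≤ 1 := min_le_right _ _
    calc |x| * (1 - plateau t x) ^ 2 ≤ t * 1 := by
          gcongr
          exact pow_le_one₀ (by linarith) (by linarith)
      _ = t := mul_one t
  · rw [plateau, min_eq_right ((one_le_div ht).2 h)]
    simpa using ht.le

lemma norm_sub_plateau_mul_sq_le {t : ℝ} (ht : 0 < t) (x : A) :
    ‖x - cfcₙ (plateau t) (x * star x) * x‖ ^ 2 ≤ t := by
  set c := x * star x with hc
  have hsa : IsSelfAdjoint c := .mul_star_self x
  set g := cfcₙ (plateau t) c with hg
  have hgs : star g = g := (IsSelfAdjoint.cfcₙ (f := plateau t) (a := c)).star_eq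
  have hgc : c - g * c - c * g + g * c * g = cfcₙ (fun s ↦ s - plateau t s * s - s * plateau t s
      + plateau t s * s * plateau t s) c := by
    rw [cfcₙ_add .., cfcₙ_sub .., cfcₙ_sub .., cfcₙ_mul .., cfcₙ_mul .., cfcₙ_mul .., cfcₙ_mul ..,
      cfcₙ_id' ℝ c]
  calc ‖x - g * x‖ ^ 2 = ‖(x - g * x) * star (x - g * x)‖ := by
        rw [CStarRing.norm_self_mul_star, sq]
    _ = ‖c - g * c - c * g + g * c * g‖ := by
        congr 1
        rw [star_sub, star_mul, hgs, hc]
        noncomm_ring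
    _ ≤ t := by
        rw [hgc]
        exact norm_cfcₙ_le fun s _ ↦ abs_mul_one_sub_plateau_sq_le ht s

lemma IsIdealOf.mem_closure_mul_image {I : Set A} (hI : IsIdealOf I Set.univ) {x : A}
    (hx : x * star x ∈ I) : x ∈ closure ((· * x) '' I) := by
  refine Metric.mem_closure_iff.2 fun ε hε ↦ ⟨_, ⟨cfcₙ (plateau ((ε / 2) ^ 2)) (x * star x),
    hI.cfcₙ_mem hx (.mul_star_self x) _, rfl⟩, ?_⟩
  have h := norm_sub_plateau_mul_sq_le (t := (ε / 2) ^ 2) (by positivity) x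
  rw [dist_eq_norm]
  linarith [(sq_le_sq₀ (norm_nonneg _) (by positivity)).1 h]

lemma IsIdealOf.mem_of_mul_star_mem {I : Set A} (hI : IsIdealOf I Set.univ) {x : A}
    (hx : x * star x ∈ I) : x ∈ I := by
  refine closure_minimal ?_ hI.isClosed (hI.mem_closure_mul_image hx)
  rintro _ ⟨e, he, rfl⟩
  exact hI.isAlgIdeal.right x he

lemma IsIdealOf.star_mem {I : Set A} (hI : IsIdealOf I Set.univ) {x : A}
    (hx : x ∈ I) : star x ∈ I :=
  hI.mem_of_mul_star_mem (by simpa using hI.isAlgIdeal.left (star x) hx)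

lemma IsIdealOf.mem_closure_image_mul {I : Set A} (hI : IsIdealOf I Set.univ) {x : A}
    (hx : x ∈ I) : x ∈ closure ((x * ·) '' I) := by
  have h := hI.mem_closure_mul_image (x := star x) (hI.isAlgIdeal.right _ (hI.star_mem hx))
  rw [← star_star x]
  refine map_mem_closure continuous_star h ?_
  rintro _ ⟨e, he, rfl⟩
  exact ⟨star e, hI.star_mem he, by simp⟩

lemma IsIdealOf.trans {I J : Set A} (hI : IsIdealOf I J) (hJ : IsIdealOf J Set.univ) :
    IsIdealOf I Set.univ := by
  obtain ⟨hIJ, hc, h0, ha, hn, hm⟩ := hI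
  refine ⟨Set.subset_univ _, hc, h0, ha, hn, fun x hx a _ ↦ ⟨?_, ?_⟩⟩
  · refine closure_minimal ?_ hc (map_mem_closure (continuous_const_mul a)
      (hJ.mem_closure_mul_image (hJ.isAlgIdeal.right _ (hIJ hx))) (Set.mapsTo_image _ _))
    rintro _ ⟨_, ⟨e, he, rfl⟩, rfl⟩
    simpa [mul_assoc] using (hm x hx _ (hJ.isAlgIdeal.left a he)).1
  · refine closure_minimal ?_ hc (map_mem_closure (f := (· * a)) (continuous_mul_const a)
      (hJ.mem_closure_image_mul (hIJ hx)) (Set.mapsTo_image _ _))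
    rintro _ ⟨_, ⟨e, he, rfl⟩, rfl⟩
    simpa [mul_assoc] using (hm x hx _ (hJ.isAlgIdeal.right a he)).2

lemma centerOf_subset_centerOf_univ {J : Set A} (hJ : IsIdealOf J Set.univ) :
    centerOf J ⊆ centerOf Set.univ := by
  refine fun z ⟨hz, hzc⟩ ↦ mem_centerOf_univ.2 fun a ↦ sub_eq_zero.1 ?_
  have h := hJ.mem_closure_image_mul (hJ.isAlgIdeal.sub (hJ.isAlgIdeal.right a hz)
    (hJ.isAlgIdeal.left a hz))
  refine closure_minimal ?_ isClosed_singleton h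
  rintro _ ⟨x, hx, rfl⟩
  simp [sub_mul, mul_assoc, hzc x hx, hzc _ (hJ.isAlgIdeal.left a hx)]

lemma mem_centerOf_of_mem {J : Set A} {z : A} (hz : z ∈ centerOf Set.univ) (hzJ : z ∈ J) :
    z ∈ centerOf J :=
  ⟨hzJ, fun x _ ↦ hz.2 x trivial⟩

lemma star_mem_centerOf {z : A} (hz : z ∈ centerOf Set.univ) : star z ∈ centerOf Set.univ := by
  rw [mem_centerOf_univ] at *
  intro x
  simpa using congrArg star (hz (star x)).symm

lemma exists_center_plateau {Q : Set A} (hQ : IsIdealOf Q Set.univ) {m : A}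
    (hm : m ∈ centerOf Set.univ) (hmQ : m ∉ Q) :
    ∃ f ∈ centerOf (Set.univ : Set A), ∃ g ∈ centerOf (Set.univ : Set A), f ∉ Q ∧ g * f = f ∧
      ∀ I : Set A, IsIdealOf I Set.univ → m ∈ I → g ∈ I := by
  set c := m * star m with hc
  have hsa : IsSelfAdjoint c := .mul_star_self m
  have hcZ : c ∈ centerOf (Set.univ : Set A) := mul_mem_centerOf_univ hm (star_mem_centerOf hm)
  obtain ⟨t, ht, htQ⟩ : ∃ t > 0, cfcₙ (threshold t) c ∉ Q := by
    by_contra! h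
    refine hmQ (hQ.mem_of_mul_star_mem (hQ.isClosed.closure_subset ?_))
    refine Metric.mem_closure_iff.2 fun ε hε ↦ ⟨_, h (ε / 2) (half_pos hε), ?_⟩
    have h0 := threshold_zero (half_pos hε)
    rw [dist_eq_norm, ← hc]
    nth_rw 1 [← cfcₙ_id' ℝ c]
    rw [← cfcₙ_sub ..]
    exact (norm_cfcₙ_le fun x _ ↦ abs_self_sub_threshold_le (half_pos hε) x).trans_lt
      (half_lt_self hε)
  have h0 := threshold_zero ht
  refine ⟨_, cfcₙ_mem_centerOf hcZ _, _, cfcₙ_mem_centerOf hcZ (plateau t), htQ, ?_,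
    fun I hI hmI ↦ hI.cfcₙ_mem (hI.isAlgIdeal.right _ hmI) hsa _⟩
  rw [← cfcₙ_mul ..]
  simp_rw [plateau_mul_threshold ht]

lemma IsModMaxIdealOf.isIdealOf {M S : Set A} (hM : IsModMaxIdealOf M S) : IsIdealOf M S := hM.1

lemma IsModMaxIdealOf.exists_relUnit_mem {M J : Set A} (hM : IsModMaxIdealOf M Set.univ)
    (hJ : IsAlgIdeal J) (hJM : ¬ J ⊆ M) : ∃ j ∈ J, IsRelUnitMod Set.univ M j := by
  obtain ⟨hMI, -, hmax, e, he⟩ := hM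
  have hsum := hJ.setAdd hMI.isAlgIdeal
  have hMs : M ⊆ J + M := fun m hm ↦ ⟨0, hJ.zero, m, hm, zero_add m⟩
  have hJs : J ⊆ J + M := fun j hj ↦ ⟨j, hj, 0, hMI.isAlgIdeal.zero, add_zero j⟩
  rcases hmax _ hsum.closure (hMs.trans subset_closure) with h | h
  · exact absurd (h ▸ hJs.trans subset_closure) hJM
  · obtain ⟨j, hj, m, hm, rfl⟩ := (he.mono hMs).mem_of_mem_closure hsum (h ▸ trivial)
    refine ⟨j, hj, trivial, fun x _ ↦ ⟨?_, ?_⟩⟩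
    · refine hMI.isAlgIdeal.mem_of_sub_mem ?_ (hMI.isAlgIdeal.left x hm)
      simpa [mul_add, sub_sub] using (he.2 x trivial).1
    · refine hMI.isAlgIdeal.mem_of_sub_mem ?_ (hMI.isAlgIdeal.right x hm)
      simpa [add_mul, sub_sub] using (he.2 x trivial).2

lemma IsModMaxIdealOf.mem_of_mul_mem {M : Set A} (hM : IsModMaxIdealOf M Set.univ) {z a : A}
    (hz : z ∈ centerOf Set.univ) (hzM : z ∉ M) (h : z * a ∈ M) : a ∈ M := by
  obtain ⟨hMI, -, hmax, e, he⟩ := hM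
  have hM' := hMI.isAlgIdeal
  rw [mem_centerOf_univ] at hz
  have hI : IsIdealOf {x | z * x ∈ M} Set.univ := isIdealOf_univ_iff.2
    ⟨hMI.isClosed.preimage (continuous_const_mul z),
    { zero := by simpa using hM'.zero
      add := fun hx hy ↦ by simpa [mul_add] using hM'.add hx hy
      neg := fun hx ↦ by simpa using hM'.neg hx
      left := fun {x} b hx ↦ by
        simpa [← mul_assoc, hz b] using hM'.left b hx
      right := fun b hx ↦ by simpa [mul_assoc] using hM'.right b hx }⟩
  rcases hmax _ hI fun x hx ↦ hM'.left z hx with h' | h'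
  · rw [← h']
    exact h
  · have : z * e ∈ M := (h' ▸ trivial : e ∈ {x | z * x ∈ M})
    exact absurd (hM'.mem_of_sub_mem (he.2 z trivial).1 this) hzM

lemma IsModMaxIdealOf.eq_of_subset {M N S : Set A} (hM : IsModMaxIdealOf M S)
    (hN : IsModMaxIdealOf N S) (h : M ⊆ N) : M = N :=
  ((hM.2.2.1 N hN.isIdealOf h).resolve_right hN.2.1).symm

lemma IsModMaxIdealOf.eq_of_inter_subset {M N J : Set A} (hM : IsModMaxIdealOf M Set.univ)
    (hN : IsModMaxIdealOf N Set.univ) (hJ : IsIdealOf J Set.univ) (hJN : ¬ J ⊆ N)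
    (h : M ∩ J ⊆ N) : M = N := by
  obtain ⟨j, hj, hjN⟩ := hN.exists_relUnit_mem hJ.isAlgIdeal hJN
  refine hM.eq_of_subset hN fun a ha ↦ hN.isIdealOf.isAlgIdeal.mem_of_sub_mem
    (hjN.2 a trivial).1 (h ⟨hM.isIdealOf.isAlgIdeal.right j ha, hJ.isAlgIdeal.left a hj⟩)

lemma IsModMaxIdealOf.inter {M J : Set A} (hM : IsModMaxIdealOf M Set.univ)
    (hJ : IsIdealOf J Set.univ) (hJM : ¬ J ⊆ M) : IsModMaxIdealOf (M ∩ J) J := by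
  obtain ⟨j, hj, hjM⟩ := hM.exists_relUnit_mem hJ.isAlgIdeal hJM
  have hjMJ : IsRelUnitMod J (M ∩ J) j := ⟨hj, fun x hx ↦
    ⟨⟨(hjM.2 x trivial).1, hJ.isAlgIdeal.sub hx (hJ.isAlgIdeal.right j hx)⟩,
      ⟨(hjM.2 x trivial).2, hJ.isAlgIdeal.sub hx (hJ.isAlgIdeal.left j hx)⟩⟩⟩
  refine ⟨hM.isIdealOf.inter hJ, fun h ↦ hJM (Set.inter_eq_right.1 h), fun I hI hMI ↦ ?_, j, hjMJ⟩
  have hIA := (hI.trans hJ).isAlgIdeal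
  by_cases hIM : I ⊆ M
  · exact .inl ((Set.subset_inter hIM hI.1).antisymm hMI)
  · obtain ⟨i, hi, hiM⟩ := hM.exists_relUnit_mem hIA hIM
    refine .inr (hI.1.antisymm fun x hx ↦ hIA.mem_of_sub_mem (hMI ⟨(hiM.2 x trivial).1, ?_⟩)
      (hIA.left x hi))
    exact hJ.isAlgIdeal.sub hx (hJ.isAlgIdeal.right i hx)

lemma IsModMaxIdealOf.exists_eq_inter {N J : Set A} (hN : IsModMaxIdealOf N J)
    (hJ : IsIdealOf J Set.univ) : ∃ M, IsModMaxIdealOf M Set.univ ∧ ¬ J ⊆ M ∧ N = M ∩ J := by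
  obtain ⟨hNJ, hne, hmax, u, hu⟩ := hN
  have hNA := hNJ.trans hJ
  have hN' := hNA.isAlgIdeal
  let M : Set A := {a | ∀ x ∈ J, a * x ∈ N ∧ x * a ∈ N}
  have hMJ : N = M ∩ J := by
    refine Set.Subset.antisymm (fun a ha ↦ ⟨fun x _ ↦ ⟨hN'.right x ha, hN'.left x ha⟩, hNJ.1 ha⟩) ?_
    exact fun a ⟨haM, haJ⟩ ↦ hN'.mem_of_sub_mem (hu.2 a haJ).1 (haM u hu.1).1
  have hM : IsIdealOf M Set.univ := by
    refine isIdealOf_univ_iff.2 ⟨?_,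
      { zero := fun x _ ↦ by simpa using hN'.zero
        add := fun ha hb x hx ↦ by
          simpa [add_mul, mul_add] using
            And.intro (hN'.add (ha x hx).1 (hb x hx).1) (hN'.add (ha x hx).2 (hb x hx).2)
        neg := fun ha x hx ↦ by
          simpa using And.intro (hN'.neg (ha x hx).1) (hN'.neg (ha x hx).2)
        left := fun {a} b ha x hx ↦ ⟨by simpa [mul_assoc] using hN'.left b (ha x hx).1,
          by simpa [mul_assoc] using (ha _ (hJ.isAlgIdeal.right b hx)).2⟩
        right := fun {a} b ha x hx ↦ ⟨by
          simpa [mul_assoc] using (ha _ (hJ.isAlgIdeal.left b hx)).1,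
          by simpa [mul_assoc] using hN'.right b (ha x hx).2⟩ }⟩
    have : M = ⋂ x ∈ J, {a | a * x ∈ N} ∩ {a | x * a ∈ N} := by
      ext a
      simp [M]
    rw [this]
    exact isClosed_biInter fun x _ ↦ (hNA.isClosed.preimage (continuous_mul_const x)).inter
      (hNA.isClosed.preimage (continuous_const_mul x))
  have huM : IsRelUnitMod Set.univ M u := by
    refine ⟨trivial, fun a _ ↦ ⟨fun x hx ↦ ⟨?_, ?_⟩, fun x hx ↦ ⟨?_, ?_⟩⟩⟩
    · simpa [mul_sub, sub_mul, mul_assoc] using hN'.left a (hu.2 x hx).2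
    · simpa [mul_sub, mul_assoc] using (hu.2 _ (hJ.isAlgIdeal.right a hx)).1
    · simpa [sub_mul, mul_assoc] using (hu.2 _ (hJ.isAlgIdeal.left a hx)).2
    · simpa [mul_sub, sub_mul, mul_assoc] using hN'.right a (hu.2 x hx).1
  have hJM : ¬ J ⊆ M := fun h ↦ hne (hMJ.trans (Set.inter_eq_right.2 h))
  refine ⟨M, ⟨hM, fun h ↦ hJM (h ▸ Set.subset_univ J), fun I hI hMI ↦ ?_, u, huM⟩, hJM, hMJ⟩
  have hIA := hI.isAlgIdeal
  rcases hmax _ (hI.inter hJ) (hMJ ▸ Set.inter_subset_inter_left J hMI) with h | h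
  · refine .inl (Set.Subset.antisymm (fun a ha x hx ↦ ?_) hMI)
    rw [← h]
    exact ⟨⟨hIA.right x ha, hJ.isAlgIdeal.left a hx⟩, ⟨hIA.left x ha, hJ.isAlgIdeal.right a hx⟩⟩
  · exact .inr ((huM.mono hMI).eq_univ hIA (Set.inter_eq_right.1 h hu.1))

lemma IsRelUnitMod.exists_isModMaxIdealOf {L : Set A} {g : A} (hL : IsAlgIdeal L)
    (hg : IsRelUnitMod Set.univ L g) (hgL : g ∉ L) :
    ∃ P, IsModMaxIdealOf P Set.univ ∧ L ⊆ P ∧ g ∉ P := by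
  obtain ⟨P, hLP, hP⟩ := zorn_subset_nonempty {I : Set A | IsAlgIdeal I ∧ L ⊆ I ∧ g ∉ I}
    (fun C hC hchain ⟨I₀, hI₀⟩ ↦ by
      refine ⟨⋃₀ C, ⟨?_, (hC hI₀).2.1.trans (Set.subset_sUnion_of_mem hI₀), ?_⟩,
        fun I hI ↦ Set.subset_sUnion_of_mem hI⟩
      · exact
        { zero := ⟨I₀, hI₀, (hC hI₀).1.zero⟩
          add := by
            rintro x y ⟨I, hI, hx⟩ ⟨I', hI', hy⟩
            rcases hchain.total hI hI' with h | h
            · exact ⟨I', hI', (hC hI').1.add (h hx) hy⟩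
            · exact ⟨I, hI, (hC hI).1.add hx (h hy)⟩
          neg := fun ⟨I, hI, hx⟩ ↦ ⟨I, hI, (hC hI).1.neg hx⟩
          left := fun a ⟨I, hI, hx⟩ ↦ ⟨I, hI, (hC hI).1.left a hx⟩
          right := fun a ⟨I, hI, hx⟩ ↦ ⟨I, hI, (hC hI).1.right a hx⟩ }
      · rintro ⟨I, hI, hgI⟩
        exact (hC hI).2.2 hgI) L ⟨hL, subset_rfl, hgL⟩
  have hgP := hg.mono hLP
  have hPA := hP.prop.1
  have hclosed : closure P = P :=
    (hP.eq_of_subset ⟨hPA.closure.isAlgIdeal, hLP.trans subset_closure,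
      fun h ↦ hP.prop.2.2 (hgP.mem_of_mem_closure hPA h)⟩ subset_closure).symm
  refine ⟨P, ⟨hclosed ▸ hPA.closure, fun h ↦ hP.prop.2.2 (h ▸ trivial), fun I hI hPI ↦ ?_, g, hgP⟩,
    hLP, hP.prop.2.2⟩
  by_cases hgI : g ∈ I
  · exact .inr ((hgP.mono hPI).eq_univ hI.isAlgIdeal hgI)
  · exact .inl (hP.eq_of_subset ⟨hI.isAlgIdeal, hLP.trans hPI, hgI⟩ hPI).symm

lemma IsModMaxIdealOf.inter_center_subset {M P : Set A} (hM : IsModMaxIdealOf M Set.univ)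
    (hP : IsModMaxIdealOf P Set.univ) (h : P ∩ centerOf Set.univ ⊆ M)
    (hZM : ¬ centerOf Set.univ ⊆ M) : M ∩ centerOf Set.univ ⊆ P := by
  rintro m ⟨hmM, hmZ⟩
  by_contra hmP
  obtain ⟨f, hf, g, hg, hfP, hgf, hgI⟩ := exists_center_plateau hP.isIdealOf hmZ hmP
  have hgM := hgI M hM.isIdealOf hmM
  have hMA := hM.isIdealOf.isAlgIdeal
  refine hZM fun z hz ↦ hMA.mem_of_sub_mem (y := g * z) (h ⟨hP.mem_of_mul_mem hf hfP ?_, ?_⟩)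
    (hMA.right z hgM)
  · rw [mul_sub, ← mul_assoc, hf.2 g trivial, hgf, sub_self]
    exact hP.isIdealOf.isAlgIdeal.zero
  · have hgz := mul_mem_centerOf_univ hg hz
    rw [mem_centerOf_univ] at *
    intro x
    rw [sub_mul, mul_sub, hz, hgz]

/-- A point of the centre lying over the hull of `K` lifts to a modular maximal ideal above `K`. -/
lemma IsModMaxIdealOf.exists_center_inter_eq {M K : Set A} (hM : IsModMaxIdealOf M Set.univ)
    (hK : IsIdealOf K Set.univ) (hZM : ¬ centerOf Set.univ ⊆ M)
    (hKM : K ∩ centerOf Set.univ ⊆ M) :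
    ∃ P, IsModMaxIdealOf P Set.univ ∧ K ⊆ P ∧ ¬ centerOf Set.univ ⊆ P ∧
      M ∩ centerOf Set.univ = P ∩ centerOf Set.univ := by
  obtain ⟨z, hz, hzM⟩ := Set.not_subset.1 hZM
  obtain ⟨f, hf, g, hg, hfM, hgf, -⟩ := exists_center_plateau hM.isIdealOf hz hzM
  have hMA := hM.isIdealOf.isAlgIdeal
  have hKA := hK.isAlgIdeal
  have hgM : g ∉ M := fun h ↦ hfM (hgf ▸ hMA.right f h)
  let L : Set A := {a | ∃ h ∈ centerOf (Set.univ : Set A), h ∉ M ∧ h * a ∈ K}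
  have hL : IsAlgIdeal L :=
    { zero := ⟨f, hf, hfM, by simpa using hKA.zero⟩
      add := by
        rintro x y ⟨h, hh, hhM, hx⟩ ⟨k, hk, hkM, hy⟩
        refine ⟨h * k, mul_mem_centerOf_univ hh hk, fun H ↦ hkM (hM.mem_of_mul_mem hh hhM H), ?_⟩
        rw [mul_add]
        refine hKA.add ?_ ?_
        · rw [hh.2 k trivial, mul_assoc]
          exact hKA.left k hx
        · rw [mul_assoc]
          exact hKA.left h hy
      neg := fun ⟨h, hh, hhM, hx⟩ ↦ ⟨h, hh, hhM, by simpa using hKA.neg hx⟩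
      left := fun {x} a ⟨h, hh, hhM, hx⟩ ↦ ⟨h, hh, hhM, by
        rw [← mul_assoc, hh.2 a trivial, mul_assoc]
        exact hKA.left a hx⟩
      right := fun a ⟨h, hh, hhM, hx⟩ ↦ ⟨h, hh, hhM, by
        rw [← mul_assoc]
        exact hKA.right a hx⟩ }
  have hKL : K ⊆ L := fun x hx ↦ ⟨f, hf, hfM, hKA.left f hx⟩
  have hgL : IsRelUnitMod Set.univ L g := by
    have key : ∀ x, x - g * x ∈ L := fun x ↦ ⟨f, hf, hfM, by
      rw [mul_sub, ← mul_assoc, hf.2 g trivial, hgf, sub_self]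
      exact hKA.zero⟩
    exact ⟨trivial, fun x _ ↦ ⟨by rw [← hg.2 x trivial]; exact key x, key x⟩⟩
  have hgnL : g ∉ L := fun ⟨h, hh, hhM, hgh⟩ ↦
    hgM (hM.mem_of_mul_mem hh hhM (hKM ⟨hgh, mul_mem_centerOf_univ hh hg⟩))
  obtain ⟨P, hP, hLP, hgP⟩ := hgL.exists_isModMaxIdealOf hL hgnL
  have hZP : ¬ centerOf Set.univ ⊆ P := fun h ↦ hgP (h hg)
  have hMP : M ∩ centerOf Set.univ ⊆ P := by
    rintro m ⟨hmM, hmZ⟩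
    by_contra hmP
    obtain ⟨k, hk, u, hu, hkP, huk, huI⟩ := exists_center_plateau hP.isIdealOf hmZ hmP
    have huM := huI M hM.isIdealOf hmM
    refine hkP (hLP ⟨g - g * u, ?_, fun h ↦ hgM (hMA.mem_of_sub_mem h (hMA.left g huM)), ?_⟩)
    · have hgu := mul_mem_centerOf_univ hg hu
      rw [mem_centerOf_univ] at *
      intro x
      rw [sub_mul, mul_sub, hg, hgu]
    · rw [sub_mul, mul_assoc, huk, sub_self]
      exact hKA.zero
  exact ⟨P, hP, hKL.trans hLP, hZP, Set.Subset.antisymm (Set.subset_inter hMP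
    Set.inter_subset_right) (Set.subset_inter (hP.inter_center_subset hM hMP hZP)
    Set.inter_subset_right)⟩

lemma isIdealOf_sInter_Tset : IsIdealOf (⋂₀ Tset (Set.univ : Set A)) Set.univ :=
  isIdealOf_univ_sInter fun _ hM ↦ hM.1.isIdealOf

lemma IsModMaxIdealOf.exists_mem_center_sInter_Tset {M : Set A} (hM : IsModMaxIdealOf M Set.univ)
    (hKM : ¬ ⋂₀ Tset Set.univ ⊆ M) : ∃ k ∈ ⋂₀ Tset Set.univ, k ∈ centerOf Set.univ ∧ k ∉ M := by
  by_contra! h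
  have hMT : M ∉ Tset Set.univ := fun hT ↦ hKM (Set.sInter_subset_of_mem hT)
  have hZM : ¬ centerOf Set.univ ⊆ M := fun hZ ↦ hMT ⟨hM, .inl hZ⟩
  obtain ⟨P, hP, hKP, hZP, hMP⟩ := hM.exists_center_inter_eq isIdealOf_sInter_Tset hZM
    fun k hk ↦ h k hk.1 hk.2
  exact hMT ⟨hM, .inr ⟨P, hP, fun h ↦ hKM (h ▸ hKP), hZM, hZP, hMP⟩⟩

lemma weaklyCentral_sInter_Tset : WeaklyCentral (⋂₀ Tset (Set.univ : Set A)) := by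
  have hK := isIdealOf_sInter_Tset (A := A)
  refine ⟨fun N hN hZ ↦ ?_, fun N₁ N₂ hN₁ hN₂ h ↦ ?_⟩
  · obtain ⟨M, hM, hKM, rfl⟩ := hN.exists_eq_inter hK
    obtain ⟨k, hkK, hkZ, hkM⟩ := hM.exists_mem_center_sInter_Tset hKM
    exact hkM (hZ (mem_centerOf_of_mem hkZ hkK)).1
  · obtain ⟨M₁, hM₁, hKM₁, rfl⟩ := hN₁.exists_eq_inter hK
    obtain ⟨M₂, hM₂, hKM₂, rfl⟩ := hN₂.exists_eq_inter hK
    have key : ∀ {M M' : Set A}, IsModMaxIdealOf M Set.univ → IsModMaxIdealOf M' Set.univ →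
        ¬ ⋂₀ Tset Set.univ ⊆ M' →
        M ∩ ⋂₀ Tset Set.univ ∩ centerOf (⋂₀ Tset Set.univ) =
          M' ∩ ⋂₀ Tset Set.univ ∩ centerOf (⋂₀ Tset Set.univ) →
        M ∩ centerOf Set.univ ⊆ M' ∩ centerOf Set.univ := by
      rintro M M' hM hM' hKM' h z ⟨hzM, hz⟩
      obtain ⟨k, hkK, hkZ, hkM⟩ := hM'.exists_mem_center_sInter_Tset hKM'
      have hkz : k * z ∈ ⋂₀ Tset Set.univ := hK.isAlgIdeal.right z hkK
      have : k * z ∈ M ∩ ⋂₀ Tset Set.univ ∩ centerOf (⋂₀ Tset Set.univ) :=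
        ⟨⟨hM.isIdealOf.isAlgIdeal.left k hzM, hkz⟩,
          mem_centerOf_of_mem (mul_mem_centerOf_univ hkZ hz) hkz⟩
      rw [h] at this
      exact ⟨hM'.mem_of_mul_mem hkZ hkM this.1.1, hz⟩
    have hZ := (key hM₁ hM₂ hKM₂ h).antisymm (key hM₂ hM₁ hKM₁ h.symm)
    obtain ⟨k₁, -, hk₁, hkM₁⟩ := hM₁.exists_mem_center_sInter_Tset hKM₁
    obtain ⟨k₂, -, hk₂, hkM₂⟩ := hM₂.exists_mem_center_sInter_Tset hKM₂
    by_contra hne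
    exact hKM₁ (Set.sInter_subset_of_mem ⟨hM₁, .inr ⟨M₂, hM₂, fun h ↦ hne (h ▸ rfl),
      fun h ↦ hkM₁ (h hk₁), fun h ↦ hkM₂ (h hk₂), hZ⟩⟩)

lemma WeaklyCentral.subset_sInter_Tset {J : Set A} (hJ : IsIdealOf J Set.univ)
    (hwc : WeaklyCentral J) : J ⊆ ⋂₀ Tset Set.univ := by
  refine Set.subset_sInter fun M ⟨hM, hT⟩ ↦ ?_
  by_contra hJM
  have hZJ := centerOf_subset_centerOf_univ hJ
  obtain ⟨z, hzJ, hzM⟩ := Set.not_subset.1 (hwc.1 _ (hM.inter hJ hJM))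
  have hzM' : z ∉ M := fun h ↦ hzM ⟨h, hzJ.1⟩
  obtain hZ | ⟨N, hN, hne, -, -, hMN⟩ := hT
  · exact hzM' (hZ (hZJ hzJ))
  · have hmem : ∀ {y}, y ∈ centerOf J → (y ∈ M ↔ y ∈ N) := fun {y} hy ↦ by
      simpa [hZJ hy] using Set.ext_iff.1 hMN y
    have hJN : ¬ J ⊆ N := fun h ↦ hzM' ((hmem hzJ).2 (h hzJ.1))
    have hEq := hwc.2 _ _ (hM.inter hJ hJM) (hN.inter hJ hJN) <| by
      ext y
      simp only [Set.mem_inter_iff]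
      exact ⟨fun ⟨⟨a, b⟩, c⟩ ↦ ⟨⟨(hmem c).1 a, b⟩, c⟩, fun ⟨⟨a, b⟩, c⟩ ↦ ⟨⟨(hmem c).2 a, b⟩, c⟩⟩
    exact hne (hN.eq_of_inter_subset hM hJ hJM (hEq ▸ Set.inter_subset_left))

end CStar

end CQP

open CQP

/-- **Theorem 3.19.** For any C*-algebra `A`, `ker T_A` is a weakly central ideal of `A`
which contains every weakly central ideal of `A`; that is, `ker T_A` is the largest
weakly central ideal of `A`. -/
theorem stmt8 {A : Type*} [NonUnitalCStarAlgebra A] :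
    IsIdealOf (⋂₀ Tset (Set.univ : Set A)) (Set.univ : Set A) ∧
    WeaklyCentral (⋂₀ Tset (Set.univ : Set A)) ∧
    ∀ J : Set A, IsIdealOf J (Set.univ : Set A) → WeaklyCentral J →
      J ⊆ ⋂₀ Tset (Set.univ : Set A) := by
  exact ⟨isIdealOf_sInter_Tset, weaklyCentral_sInter_Tset,
    fun _ hJ hwc ↦ hwc.subset_sInter_Tset hJ⟩
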